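/- Let n ≥ 1, 0 < α < 2, t > 0, and s < 2 − n/2. Then ∫_{ℝⁿ} (1 + |ξ|²)^s |E_α(−|ξ|² t^α)|² dξ < ∞. In other words, the tempered distribution w_α(·,t) on ℝⁿ whose Fourier transform is ξ ↦ E_α(−|ξ|²t^α) belongs to H^s(ℝⁿ) for every s < 2 − n/2. -/

import Mathlib

open MeasureTheory

/-- The Mittag-Leffler function on the reals. -/
noncomputable def mittagLeffler (α : ℝ) (x : ℝ) : ℝ :=
  ∑' k : ℕ, x ^ k / Real.Gamma (1 + α * k)


open Complex in
lemma ml_inv_Gamma_half (b : ℝ) :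
    ‖(Gamma (1/2 + b * I))⁻¹‖ ≤ Real.exp (Real.pi / 2 * |b|) / Real.sqrt Real.pi := by
  have hrefl := Gamma_mul_Gamma_one_sub (1/2 + b * I)
  have hconj : Gamma (1 - (1/2 + b * I)) = (starRingEnd ℂ) (Gamma (1/2 + b * I)) := by
    rw [← Gamma_conj]
    congr 1
    apply Complex.ext <;> simp <;> norm_num
  have hs : sin (Real.pi * (1/2 + b * I)) = (Real.cosh (Real.pi * b) : ℂ) := by
    rw [show (Real.pi : ℂ) * (1/2 + b * I) = (Real.pi * b : ℂ) * I + Real.pi / 2 by ring,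
      sin_add_pi_div_two, cos_mul_I]
    push_cast; rfl
  rw [hconj, hs, Complex.mul_conj] at hrefl
  have h1 : ‖Gamma (1/2 + b * I)‖ ^ 2 = Real.pi / Real.cosh (Real.pi * b) := by
    rw [← Complex.normSq_eq_norm_sq]; exact_mod_cast hrefl
  have hc : Real.cosh (Real.pi * b) ≤ Real.exp (Real.pi * |b|) := by
    rw [← Real.cosh_abs, abs_mul, abs_of_pos Real.pi_pos, Real.cosh_eq]
    have : Real.exp (-(Real.pi * |b|)) ≤ Real.exp (Real.pi * |b|) := by
      apply Real.exp_le_exp.2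
      have : 0 ≤ Real.pi * |b| := by positivity
      linarith
    linarith
  rw [norm_inv]
  refine (le_abs_self _).trans (abs_le_of_sq_le_sq ?_ (by positivity))
  rw [inv_pow, h1, div_pow, Real.sq_sqrt Real.pi_pos.le, ← Real.exp_nat_mul, inv_div]
  have : ((2:ℕ):ℝ) * (Real.pi / 2 * |b|) = Real.pi * |b| := by push_cast; ring
  rw [this]
  gcongr

open Complex in
lemma ml_inv_Gamma (a b : ℝ) (ha : 1/2 < a) :
    ‖(Gamma (a + b * I))⁻¹‖ ≤ Real.exp (Real.pi / 2 * |b|) / Real.Gamma a := by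
  have hu : 0 < ((a - 1/2 : ℝ) : ℂ).re := by simp; linarith
  have hv : 0 < (1/2 + b * I : ℂ).re := by simp
  have hv2 : 0 < ((1/2 : ℝ) : ℂ).re := by simp
  have e1 := Gamma_mul_Gamma_eq_betaIntegral hu hv
  have e2 := Gamma_mul_Gamma_eq_betaIntegral hu hv2
  have hB : ‖betaIntegral ((a - 1/2 : ℝ) : ℂ) (1/2 + b * I)‖ ≤
      ‖betaIntegral ((a - 1/2 : ℝ) : ℂ) ((1/2 : ℝ) : ℂ)‖ := by
    have hr : betaIntegral ((a - 1/2 : ℝ) : ℂ) ((1/2 : ℝ) : ℂ) =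
        ((∫ x in (0:ℝ)..1, x ^ (a - 1/2 - 1) * (1 - x) ^ ((1/2 : ℝ) - 1) : ℝ) : ℂ) := by
      rw [betaIntegral, ← intervalIntegral.integral_ofReal]
      apply intervalIntegral.integral_congr
      intro x hx
      rw [Set.uIcc_of_le zero_le_one] at hx
      have h1 : 0 ≤ 1 - x := by linarith [hx.2]
      simp only
      rw [ofReal_mul, ofReal_cpow hx.1, ofReal_cpow h1]
      push_cast; rfl
    have hpos : 0 ≤ ∫ x in (0:ℝ)..1, x ^ (a - 1/2 - 1) * (1 - x) ^ ((1/2 : ℝ) - 1) := by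
      apply intervalIntegral.integral_nonneg zero_le_one
      intro x hx
      have h1 : 0 ≤ 1 - x := by linarith [hx.2]
      have h2 := hx.1
      positivity
    rw [hr, norm_real, Real.norm_of_nonneg hpos, betaIntegral]
    refine (intervalIntegral.norm_integral_le_integral_norm zero_le_one).trans (le_of_eq ?_)
    rw [intervalIntegral.integral_of_le zero_le_one, intervalIntegral.integral_of_le zero_le_one,
      integral_Ioc_eq_integral_Ioo, integral_Ioc_eq_integral_Ioo]
    apply setIntegral_congr_fun measurableSet_Ioo
    intro x hx
    have h1 : 0 < 1 - x := by linarith [hx.2]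
    simp only [norm_mul]
    rw [norm_cpow_eq_rpow_re_of_pos hx.1, show (1 - (x:ℂ)) = ((1 - x : ℝ) : ℂ) by push_cast; rfl,
      norm_cpow_eq_rpow_re_of_pos h1]
    simp
  have s1 : ((a - 1/2 : ℝ) : ℂ) + (1/2 + b * I) = a + b * I := by push_cast; ring
  have s2 : ((a - 1/2 : ℝ) : ℂ) + ((1/2 : ℝ) : ℂ) = (a : ℝ) := by push_cast; ring
  rw [s1] at e1
  rw [s2, Gamma_ofReal, Gamma_ofReal, Gamma_ofReal] at e2
  rw [Gamma_ofReal] at e1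
  have n1 := congrArg norm e1
  have n2 := congrArg norm e2
  have p1 : 0 < Real.Gamma (a - 1/2) := Real.Gamma_pos_of_pos (by linarith)
  have p2 : 0 < Real.Gamma a := Real.Gamma_pos_of_pos (by linarith)
  have hh := ml_inv_Gamma_half b
  have p3 : 0 < ‖Gamma (1/2 + b * I)‖ := norm_pos_iff.2 (Gamma_ne_zero_of_re_pos hv)
  have p4 : 0 < ‖Gamma (a + b * I)‖ :=
    norm_pos_iff.2 (Gamma_ne_zero_of_re_pos (by simp; linarith))
  have p5 : 0 < Real.sqrt Real.pi := Real.sqrt_pos.2 Real.pi_pos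
  rw [Real.Gamma_one_half_eq] at n2
  simp only [norm_mul, norm_real, Real.norm_of_nonneg p1.le, Real.norm_of_nonneg p2.le,
    Real.norm_of_nonneg p5.le] at n1 n2
  rw [norm_inv] at hh ⊢
  set B := ‖betaIntegral ((a - 1/2 : ℝ) : ℂ) (1/2 + b * I)‖
  set B' := ‖betaIntegral ((a - 1/2 : ℝ) : ℂ) ((1/2 : ℝ) : ℂ)‖
  set g := ‖Gamma (1/2 + b * I)‖
  set G := ‖Gamma (a + b * I)‖
  set X := Real.exp (Real.pi / 2 * |b|)
  have hX : Real.sqrt Real.pi ≤ X * g := by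
    rw [inv_le_iff_one_le_mul₀ p3] at hh
    have := mul_le_mul_of_nonneg_left hh p5.le
    calc _ = Real.sqrt Real.pi * 1 := by ring
      _ ≤ _ := this
      _ = X * g := by field_simp
  -- Ga B' = Gu √π ≤ Gu X g = X G B ≤ X G B'
  have hB' : 0 < B' := by
    by_contra hcon
    have : 0 < Real.Gamma a * B' := by rw [← n2]; positivity
    exact hcon (pos_of_mul_pos_right this p2.le)
  have key : Real.Gamma a * B' ≤ X * G * B' := by
    calc Real.Gamma a * B' = Real.Gamma (a - 1/2) * Real.sqrt Real.pi := n2.symm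
      _ ≤ Real.Gamma (a - 1/2) * (X * g) := by gcongr
      _ = X * (Real.Gamma (a - 1/2) * g) := by ring
      _ = X * (G * B) := by rw [n1]
      _ ≤ X * (G * B') := by gcongr
      _ = _ := by ring
  have key2 := le_of_mul_le_mul_right key hB'
  rw [le_div_iff₀ p2, inv_mul_le_iff₀ p4]
  linarith

lemma ml_Gamma_lower (R y : ℝ) (hR : 0 < R) (hy : 1 ≤ y) :
    R ^ (y - 1) * Real.exp (-R) ≤ Real.Gamma y := by
  rw [Real.Gamma_eq_integral (by linarith)]
  have hint := Real.GammaIntegral_convergent (s := y) (by linarith)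
  have hsub : Set.Ioi R ⊆ Set.Ioi (0:ℝ) := Set.Ioi_subset_Ioi hR.le
  calc R ^ (y - 1) * Real.exp (-R) = ∫ x in Set.Ioi R, R ^ (y - 1) * Real.exp (-x) := by
        rw [integral_const_mul, integral_exp_neg_Ioi]
    _ ≤ ∫ x in Set.Ioi R, Real.exp (-x) * x ^ (y - 1) := by
        apply setIntegral_mono_on ((integrableOn_exp_neg_Ioi R).const_mul _)
          (hint.mono_set hsub) measurableSet_Ioi
        intro x hx
        rw [mul_comm]
        have : R ≤ x := le_of_lt hx
        gcongr
    _ ≤ _ := by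
        apply setIntegral_mono_set hint _ (LE.le.eventuallyLE hsub)
        filter_upwards [ae_restrict_mem measurableSet_Ioi] with x hx
        have : 0 < x := hx
        simp only [Pi.zero_apply]
        positivity

open Complex in
lemma ml_inv_Gamma_poly (A κ : ℝ) (hκ : Real.pi / 2 < κ) :
    ∃ K : ℝ, 0 ≤ K ∧ ∀ a b : ℝ, -1 ≤ a → a ≤ A →
      ‖(Gamma (a + b * I))⁻¹‖ ≤ K * Real.exp (κ * |b|) := by
  set ε := κ - Real.pi / 2 with hε
  have hε0 : 0 < ε := by rw [hε]; linarith
  set M := |A| + 2 with hM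
  have hM0 : 0 < M := by positivity
  refine ⟨(M + 2/ε)^2 * Real.exp 1, by positivity, fun a b h1 h2 => ?_⟩
  set z : ℂ := a + b * I with hz
  have hrec : (Gamma z)⁻¹ = z * ((z + 1) * (Gamma (((a + 2 : ℝ) : ℂ) + b * I))⁻¹) := by
    rw [one_div_Gamma_eq_self_mul_one_div_Gamma_add_one,
      one_div_Gamma_eq_self_mul_one_div_Gamma_add_one (z + 1)]
    congr 4
    rw [hz]; push_cast; ring
  have hz1 : ‖z‖ ≤ M + |b| := by
    calc ‖z‖ ≤ ‖(a:ℂ)‖ + ‖(b:ℂ) * I‖ := norm_add_le _ _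
      _ = |a| + |b| := by simp
      _ ≤ _ := by
        gcongr
        rw [abs_le]; constructor <;> linarith [neg_abs_le A, le_abs_self A, abs_nonneg A]
  have hz2 : ‖z + 1‖ ≤ M + |b| := by
    calc ‖z + 1‖ = ‖((a + 1 : ℝ):ℂ) + (b:ℂ) * I‖ := by rw [hz]; push_cast; ring_nf
      _ ≤ ‖((a + 1 : ℝ):ℂ)‖ + ‖(b:ℂ) * I‖ := norm_add_le _ _
      _ = |a + 1| + |b| := by rw [norm_real]; simp
      _ ≤ _ := by
        gcongr
        rw [abs_le]; constructor <;> linarith [neg_abs_le A, le_abs_self A, abs_nonneg A]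
  have hG := ml_inv_Gamma (a + 2) b (by linarith)
  have hL := ml_Gamma_lower 1 (a + 2) one_pos (by linarith)
  rw [Real.one_rpow, one_mul] at hL
  have hG2 : ‖(Gamma (((a + 2 : ℝ) : ℂ) + b * I))⁻¹‖ ≤
      Real.exp 1 * Real.exp (Real.pi / 2 * |b|) := by
    refine hG.trans ?_
    calc Real.exp (Real.pi / 2 * |b|) / Real.Gamma (a + 2)
        ≤ Real.exp (Real.pi / 2 * |b|) / Real.exp (-1) := by gcongr
      _ = _ := by rw [Real.exp_neg, div_inv_eq_mul, mul_comm]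
  have hpoly : M + |b| ≤ (M + 2/ε) * Real.exp (ε / 2 * |b|) := by
    have h3 := Real.add_one_le_exp (ε / 2 * |b|)
    calc M + |b| ≤ (M + 2/ε) * (ε / 2 * |b| + 1) := by
          have : (M + 2/ε) * (ε / 2 * |b| + 1) = M * ε / 2 * |b| + |b| + M + 2/ε := by
            field_simp; ring
          rw [this]
          have : 0 ≤ M * ε / 2 * |b| := by positivity
          have : 0 < 2/ε := by positivity
          linarith
      _ ≤ _ := by gcongr
  rw [hrec, norm_mul, norm_mul]
  calc ‖z‖ * (‖z + 1‖ * ‖(Gamma (((a + 2 : ℝ) : ℂ) + b * I))⁻¹‖)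
      ≤ ((M + 2/ε) * Real.exp (ε / 2 * |b|)) * (((M + 2/ε) * Real.exp (ε / 2 * |b|)) *
        (Real.exp 1 * Real.exp (Real.pi / 2 * |b|))) := by
        gcongr
        · exact hz1.trans hpoly
        · exact hz2.trans hpoly
    _ = (M + 2/ε)^2 * Real.exp 1 * (Real.exp (ε / 2 * |b|) * Real.exp (ε / 2 * |b|) *
        Real.exp (Real.pi / 2 * |b|)) := by ring
    _ = _ := by
        rw [← Real.exp_add, ← Real.exp_add]
        congr 2
        rw [hε]; ring

lemma ml_summable (α : ℝ) (hα : 0 < α) (x : ℝ) :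
    Summable fun k : ℕ => x ^ k / Real.Gamma (1 + α * k) := by
  set R := (2 * (|x| + 1)) ^ (1/α) with hR
  have hR0 : 0 < R := by positivity
  have hRα : R ^ α = 2 * (|x| + 1) := by
    rw [hR, ← Real.rpow_mul (by positivity), one_div_mul_cancel hα.ne', Real.rpow_one]
  apply Summable.of_norm_bounded (g := fun k : ℕ => Real.exp R * (1/2 : ℝ) ^ k)
    (summable_geometric_two.mul_left _)
  intro k
  have h := ml_Gamma_lower R (1 + α * k) hR0 (by nlinarith [k.cast_nonneg (α := ℝ)])
  rw [show 1 + α * k - 1 = α * k by ring, Real.rpow_mul hR0.le, hRα, Real.rpow_natCast] at h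
  have hp : 0 < (2 * (|x| + 1)) ^ k * Real.exp (-R) := by positivity
  rw [norm_div, norm_pow, Real.norm_eq_abs, Real.norm_of_nonneg (hp.le.trans h)]
  calc |x| ^ k / Real.Gamma (1 + α * k) ≤ |x| ^ k / ((2 * (|x| + 1)) ^ k * Real.exp (-R)) := by
        gcongr
    _ ≤ (|x| + 1) ^ k / ((2 * (|x| + 1)) ^ k * Real.exp (-R)) := by gcongr; linarith
    _ = _ := by
      rw [mul_pow, Real.exp_neg]; field_simp; rw [← mul_pow]; norm_num


open Complex in
lemma ml_sin_eq (c τ : ℝ) : sin (Real.pi * (c + τ * I)) =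
    (Real.sin (Real.pi * c) * Real.cosh (Real.pi * τ) : ℝ) +
      (Real.cos (Real.pi * c) * Real.sinh (Real.pi * τ) : ℝ) * I := by
  rw [show (Real.pi : ℂ) * (c + τ * I) = (Real.pi * c : ℂ) + (Real.pi * τ : ℂ) * I by ring,
    sin_add_mul_I]
  push_cast; rfl

open Complex in
lemma ml_sin_lower (c τ : ℝ) (hc : 0 < c) (hc1 : c < 1) :
    Real.sin (Real.pi * c) / 2 * Real.exp (Real.pi * |τ|) ≤ ‖sin (Real.pi * (c + τ * I))‖ := by
  have hs : 0 < Real.sin (Real.pi * c) := Real.sin_pos_of_pos_of_lt_pi (by positivity)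
    (by nlinarith [Real.pi_pos])
  have h1 := Complex.re_le_norm (sin (Real.pi * (c + τ * I)))
  refine le_trans ?_ h1
  rw [ml_sin_eq]
  simp only [add_re, ofReal_re, mul_re, I_re, ofReal_im, I_im, mul_zero, zero_mul, sub_zero,
    add_zero, mul_one, sub_self]
  rw [← Real.cosh_abs, abs_mul, abs_of_pos Real.pi_pos, Real.cosh_eq]
  have := Real.exp_pos (-(Real.pi * |τ|))
  rw [div_mul_eq_mul_div, mul_div_assoc]
  gcongr
  linarith

open Complex in
lemma ml_sin_lower_h (a τ : ℝ) (hτ : 1 ≤ |τ|) :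
    1 / 4 * Real.exp (Real.pi * |τ|) ≤ ‖sin (Real.pi * (a + τ * I))‖ := by
  have h1 : |Real.sinh (Real.pi * τ)| ≤ ‖sin (Real.pi * (a + τ * I))‖ := by
    apply abs_le_of_sq_le_sq _ (norm_nonneg _)
    rw [← normSq_eq_norm_sq, ml_sin_eq, normSq_add_mul_I]
    have e1 := Real.sin_sq_add_cos_sq (Real.pi * a)
    have e2 := Real.cosh_sq (Real.pi * τ)
    have : (Real.sin (Real.pi * a) * Real.cosh (Real.pi * τ)) ^ 2 +
      (Real.cos (Real.pi * a) * Real.sinh (Real.pi * τ)) ^ 2 =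
      Real.sin (Real.pi * a) ^ 2 + Real.sinh (Real.pi * τ) ^ 2 := by
      rw [mul_pow, mul_pow, e2]
      linear_combination (Real.sinh (Real.pi * τ))^2 * e1
    rw [this]
    nlinarith [sq_nonneg (Real.sin (Real.pi * a))]
  refine le_trans ?_ h1
  rw [Real.abs_sinh, abs_mul, abs_of_pos Real.pi_pos, Real.sinh_eq]
  have hp : 1 ≤ Real.pi * |τ| := by nlinarith [Real.pi_gt_three]
  have h2 := Real.add_one_le_exp (Real.pi * |τ|)
  have h3 : Real.exp (-(Real.pi * |τ|)) ≤ 1 := Real.exp_le_one_iff.2 (by linarith)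
  linarith

open Complex in
lemma ml_sin_ne (c τ : ℝ) (hc : 0 < c) (hc1 : c < 1) : sin (Real.pi * (c + τ * I)) ≠ 0 := by
  have hs : 0 < Real.sin (Real.pi * c) := Real.sin_pos_of_pos_of_lt_pi (by positivity)
    (by nlinarith [Real.pi_pos])
  have := ml_sin_lower c τ hc hc1
  rw [← norm_pos_iff]
  refine lt_of_lt_of_le ?_ this
  positivity

lemma ml_exp_int (k : ℝ) (hk : k < 0) : Integrable fun τ : ℝ => Real.exp (k * |τ|) := by
  have h : IntegrableOn (fun τ : ℝ => Real.exp (k * τ)) (Set.Ioi 0) :=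
    integrableOn_exp_mul_Ioi hk 0
  have h2 : IntegrableOn (fun τ : ℝ => Real.exp (k * |τ|)) (Set.Ioi 0) :=
    h.congr_fun (fun x hx => by simp only [abs_of_pos (show 0 < x from hx)]) measurableSet_Ioi
  have h3 : IntegrableOn (fun τ : ℝ => Real.exp (k * |τ|)) (Set.Iic 0) :=
    (integrableOn_exp_mul_Iic (a := -k) (by linarith) 0).congr_fun
      (fun x hx => by simp only [abs_of_nonpos (show x ≤ 0 from hx)]; ring_nf) measurableSet_Iic
  rw [← integrableOn_univ, ← Set.Iic_union_Ioi (a := (0:ℝ))]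
  exact h3.union h2

open Complex in
/-- the weight -/
lemma ml_w_int (c κ : ℝ) (hc : 0 < c) (hc1 : c < 1) (hκ : κ < Real.pi) :
    Integrable fun τ : ℝ => Real.exp (κ * |τ|) * ‖sin (Real.pi * (c + τ * I))‖⁻¹ := by
  have hs : 0 < Real.sin (Real.pi * c) := Real.sin_pos_of_pos_of_lt_pi (by positivity)
    (by nlinarith [Real.pi_pos])
  refine ((ml_exp_int (κ - Real.pi) (by linarith)).const_mul (2 / Real.sin (Real.pi * c))).mono'
    ?_ ?_
  · apply Continuous.aestronglyMeasurable
    refine Continuous.mul (by fun_prop) (Continuous.inv₀ (by fun_prop) ?_)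
    intro τ
    exact norm_ne_zero_iff.2 (ml_sin_ne c τ hc hc1)
  · refine Filter.Eventually.of_forall fun τ => ?_
    rw [Real.norm_of_nonneg (by positivity), ← div_eq_mul_inv,
      div_le_iff₀ (norm_pos_iff.2 (ml_sin_ne c τ hc hc1))]
    calc Real.exp (κ * |τ|) = 2 / Real.sin (Real.pi * c) * Real.exp ((κ - Real.pi) * |τ|) *
          (Real.sin (Real.pi * c) / 2 * Real.exp (Real.pi * |τ|)) := by
          rw [show κ * |τ| = (κ - Real.pi) * |τ| + Real.pi * |τ| by ring, Real.exp_add]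
          field_simp
      _ ≤ _ := by
          gcongr
          exact ml_sin_lower c τ hc hc1

open Complex in
lemma ml_line_int (c κ K : ℝ) (hc : 0 < c) (hc1 : c < 1) (hκ : κ < Real.pi) (ψ : ℝ → ℂ)
    (hψ : Continuous ψ) (hb : ∀ τ, ‖ψ τ‖ ≤ K * Real.exp (κ * |τ|)) :
    Integrable (fun τ : ℝ => ψ τ / sin (Real.pi * (c + τ * I))) ∧
    ‖∫ τ : ℝ, ψ τ / sin (Real.pi * (c + τ * I))‖ ≤
      K * ∫ τ : ℝ, Real.exp (κ * |τ|) * ‖sin (Real.pi * (c + τ * I))‖⁻¹ := by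
  have hw := (ml_w_int c κ hc hc1 hκ).const_mul K
  have hle : ∀ τ : ℝ, ‖ψ τ / sin (Real.pi * (c + τ * I))‖ ≤
      K * (Real.exp (κ * |τ|) * ‖sin (Real.pi * (c + τ * I))‖⁻¹) := by
    intro τ
    rw [norm_div, div_eq_mul_inv, ← mul_assoc]
    gcongr
    exact hb τ
  constructor
  · refine hw.mono' ?_ (Filter.Eventually.of_forall hle)
    apply Continuous.aestronglyMeasurable
    exact Continuous.div hψ (by fun_prop) (fun τ => ml_sin_ne c τ hc hc1)
  · rw [← integral_const_mul]
    exact norm_integral_le_of_norm_le hw (Filter.Eventually.of_forall hle)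

open Complex in
lemma ml_S_ne (c : ℝ) (hc : 0 < c) (hc1 : c < 1) :
    (∫ τ : ℝ, 1 / sin (Real.pi * (c + τ * I))) ≠ 0 := by
  have hs : 0 < Real.sin (Real.pi * c) := Real.sin_pos_of_pos_of_lt_pi (by positivity)
    (by nlinarith [Real.pi_pos])
  have hint := (ml_line_int c 0 1 hc hc1 Real.pi_pos (fun _ => 1) continuous_const
    (fun τ => by simp)).1
  intro h0
  have h1 : (∫ τ : ℝ, (1 / sin (Real.pi * (c + τ * I))).re) = 0 := by
    have h2 := integral_re hint
    rw [h0] at h2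
    simpa using h2
  have hpos : ∀ τ : ℝ, 0 < (1 / sin (Real.pi * (c + τ * I))).re := by
    intro τ
    rw [one_div, inv_re]
    apply div_pos _ (normSq_pos.2 (ml_sin_ne c τ hc hc1))
    rw [ml_sin_eq]
    simp only [add_re, ofReal_re, mul_re, I_re, ofReal_im, I_im, mul_zero, zero_mul, sub_zero,
      add_zero, mul_one, sub_self]
    have := Real.cosh_pos (Real.pi * τ)
    positivity
  have h3 := (integral_pos_iff_support_of_nonneg (fun τ => (hpos τ).le) hint.re).2 ?_
  · exact h3.ne' h1
  · have : Function.support (fun τ : ℝ => (1 / sin (Real.pi * (c + τ * I))).re) = Set.univ := by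
      ext τ; simp only [Function.mem_support, Set.mem_univ, iff_true]; exact (hpos τ).ne'
    change 0 < volume (Function.support (fun τ : ℝ => (1 / sin (Real.pi * (c + τ * I))).re))
    rw [this]; simp

open Complex Filter Topology in
lemma ml_shift (c κ K : ℝ) (hc : 0 < c) (hc1 : c < 1) (hκ0 : 0 ≤ κ) (hκ : κ < Real.pi)
    (φ : ℂ → ℂ) (hφ : Differentiable ℂ φ)
    (hb : ∀ a τ : ℝ, c - 1 ≤ a → a ≤ c → ‖φ (a + τ * I)‖ ≤ K * Real.exp (κ * |τ|)) :
    (∫ τ : ℝ, φ (c + τ * I) / sin (Real.pi * (c + τ * I))) +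
      (∫ τ : ℝ, φ ((c - 1 : ℝ) + τ * I) / sin (Real.pi * (c + τ * I))) =
      2 * φ 0 * ∫ τ : ℝ, 1 / sin (Real.pi * (c + τ * I)) := by
  have hK : ‖φ 0‖ ≤ K := by
    have := hb 0 0 (by linarith) hc.le
    simpa using this
  have hK0 : 0 ≤ K := (norm_nonneg _).trans hK
  have i1 := (ml_line_int c κ K hc hc1 hκ (fun τ => φ (c + τ * I))
    (hφ.continuous.comp (by fun_prop)) (fun τ => hb c τ (by linarith) le_rfl)).1
  have i2 := (ml_line_int c κ K hc hc1 hκ (fun τ => φ ((c - 1 : ℝ) + τ * I))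
    (hφ.continuous.comp (by fun_prop)) (fun τ => hb (c - 1) τ le_rfl (by linarith))).1
  have i3 := (ml_line_int c 0 1 hc hc1 Real.pi_pos (fun _ => 1) continuous_const
    (fun τ => by simp)).1
  -- the regularised function
  set σ : ℂ → ℂ := fun s => sin (Real.pi * s) with hσ
  have hσd : Differentiable ℂ σ := by
    intro s; simp only [hσ]; fun_prop
  set U : Set ℂ := {s | -1 < s.re ∧ s.re < 1} with hU
  have hσne : ∀ s ∈ U, s ≠ 0 → σ s ≠ 0 := by
    intro s hs hs0 h
    simp only [hσ] at h
    rw [Complex.sin_eq_zero_iff] at h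
    obtain ⟨k, hk⟩ := h
    have hpi : (Real.pi : ℂ) ≠ 0 := by exact_mod_cast Real.pi_ne_zero
    have hsk : s = k := by
      apply mul_left_cancel₀ hpi
      rw [hk]; ring
    rw [hsk] at hs hs0
    have h1 : (-1 : ℝ) < k := by simpa using hs.1
    have h2 : (k : ℝ) < 1 := by simpa using hs.2
    have h1' : (-1 : ℤ) < k := by exact_mod_cast h1
    have h2' : k < 1 := by exact_mod_cast h2
    apply hs0
    have : k = 0 := by omega
    simp [this]
  have hσ0 : σ 0 = 0 := by simp [hσ]
  have hdσ : deriv σ 0 = Real.pi := by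
    have : HasDerivAt σ (cos (Real.pi * 0) * (Real.pi * 1)) 0 :=
      (HasDerivAt.const_mul (Real.pi : ℂ) (hasDerivAt_id (0:ℂ))).csin
    rw [this.deriv]; simp
  set h : ℂ → ℂ := fun s => dslope φ 0 s / dslope σ 0 s with hh
  have hhne : ∀ s, s ≠ 0 → h s = (φ s - φ 0) / σ s := by
    intro s hs
    simp only [hh, dslope_of_ne _ hs, slope_def_field, hσ0, sub_zero]
    rw [div_div_div_cancel_right₀ hs]
  have hd1 : Differentiable ℂ (dslope φ 0) := by
    rw [← differentiableOn_univ]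
    exact (differentiableOn_dslope univ_mem).2 hφ.differentiableOn
  have hd2 : Differentiable ℂ (dslope σ 0) := by
    rw [← differentiableOn_univ]
    exact (differentiableOn_dslope univ_mem).2 hσd.differentiableOn
  have hhd : DifferentiableOn ℂ h U := by
    intro s hs
    refine DifferentiableWithinAt.div (hd1 s).differentiableWithinAt
      (hd2 s).differentiableWithinAt ?_
    by_cases h0 : s = 0
    · rw [h0, dslope_same, hdσ]; exact_mod_cast Real.pi_ne_zero
    · rw [dslope_of_ne _ h0, slope_def_field, hσ0, sub_zero, sub_zero]
      exact div_ne_zero (hσne s hs h0) h0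
  -- line values
  have l1 : ∀ τ : ℝ, h (c + τ * I) = φ (c + τ * I) / sin (Real.pi * (c + τ * I)) -
      φ 0 * (1 / sin (Real.pi * (c + τ * I))) := by
    intro τ
    rw [hhne _ (fun h0 => by have := congrArg re h0; simp at this; exact hc.ne' this)]
    simp only [hσ]; ring
  have l2 : ∀ τ : ℝ, h ((c - 1 : ℝ) + τ * I) =
      φ 0 * (1 / sin (Real.pi * (c + τ * I))) -
      φ ((c - 1 : ℝ) + τ * I) / sin (Real.pi * (c + τ * I)) := by
    intro τ
    rw [hhne _ (fun h0 => by have := congrArg re h0; simp at this; linarith)]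
    have : σ ((c - 1 : ℝ) + τ * I) = - sin (Real.pi * (c + τ * I)) := by
      simp only [hσ]
      rw [← sin_sub_pi]; congr 1; push_cast; ring
    rw [this, div_neg]; ring
  have i1' : Integrable fun τ : ℝ => h (c + τ * I) := by
    simp_rw [l1]; exact i1.sub (i3.const_mul _)
  have i2' : Integrable fun τ : ℝ => h ((c - 1 : ℝ) + τ * I) := by
    simp_rw [l2]; exact (i3.const_mul _).sub i2
  -- horizontal bound
  have hhor : ∀ a τ : ℝ, c - 1 ≤ a → a ≤ c → 1 ≤ |τ| →
      ‖h (a + τ * I)‖ ≤ 8 * K * Real.exp ((κ - Real.pi) * |τ|) := by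
    intro a τ ha1 ha2 hτ
    have hne : (a + τ * I : ℂ) ≠ 0 := fun h0 => by
      have := congrArg im h0; simp at this; rw [this] at hτ; norm_num at hτ
    have hsl := ml_sin_lower_h a τ hτ
    have hsp : 0 < ‖sin (Real.pi * (a + τ * I))‖ := lt_of_lt_of_le (by positivity) hsl
    rw [hhne _ hne, norm_div]
    simp only [hσ]
    rw [div_le_iff₀ hsp]
    have he : 1 ≤ Real.exp (κ * |τ|) := Real.one_le_exp (by positivity)
    calc ‖φ (a + τ * I) - φ 0‖ ≤ ‖φ (a + τ * I)‖ + ‖φ 0‖ := norm_sub_le _ _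
      _ ≤ K * Real.exp (κ * |τ|) + K * Real.exp (κ * |τ|) := by
        gcongr
        · exact hb a τ ha1 ha2
        · nlinarith
      _ = 8 * K * Real.exp ((κ - Real.pi) * |τ|) * (1 / 4 * Real.exp (Real.pi * |τ|)) := by
        rw [show κ * |τ| = (κ - Real.pi) * |τ| + Real.pi * |τ| by ring, Real.exp_add]; ring
      _ ≤ _ := by gcongr
  have hrect : ∀ T : ℝ, (∫ x : ℝ in (c-1)..c, h (x + (-T : ℝ) * I)) -
      (∫ x : ℝ in (c-1)..c, h (x + T * I)) +
      I • (∫ y : ℝ in (-T)..T, h (c + y * I)) -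
      I • (∫ y : ℝ in (-T)..T, h ((c - 1 : ℝ) + y * I)) = 0 := by
    intro T
    have := integral_boundary_rect_eq_zero_of_differentiableOn h (⟨c - 1, -T⟩ : ℂ) (⟨c, T⟩ : ℂ) ?_
    · exact this
    · apply hhd.mono
      intro s hs
      have := hs.1
      simp only [Set.mem_preimage] at this
      rw [Set.uIcc_of_le (by linarith)] at this
      exact ⟨by linarith [this.1], by linarith [this.2]⟩
  have hlim0 : Tendsto (fun T : ℝ => 8 * K * Real.exp ((κ - Real.pi) * T)) atTop (𝓝 0) := by
    have : Tendsto (fun T : ℝ => (κ - Real.pi) * T) atTop atBot :=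
      tendsto_id.const_mul_atTop_of_neg (by linarith)
    simpa using (Real.tendsto_exp_atBot.comp this).const_mul (8 * K)
  have hh1 : Tendsto (fun T : ℝ => ∫ x : ℝ in (c-1)..c, h (x + T * I)) atTop (𝓝 0) := by
    apply squeeze_zero_norm' _ hlim0
    filter_upwards [eventually_ge_atTop 1] with T hT
    have hT' : |T| = T := abs_of_pos (by linarith)
    have := intervalIntegral.norm_integral_le_of_norm_le_const (a := c - 1) (b := c)
      (f := fun x : ℝ => h (x + T * I)) (C := 8 * K * Real.exp ((κ - Real.pi) * T)) ?_
    · simpa using this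
    · intro x hx
      rw [Set.uIoc_of_le (by linarith)] at hx
      simpa [hT'] using hhor x T hx.1.le hx.2 (by rw [hT']; exact hT)
  have hh2 : Tendsto (fun T : ℝ => ∫ x : ℝ in (c-1)..c, h (x + (-T : ℝ) * I)) atTop (𝓝 0) := by
    apply squeeze_zero_norm' _ hlim0
    filter_upwards [eventually_ge_atTop 1] with T hT
    have hT' : |-T| = T := by rw [abs_neg]; exact abs_of_pos (by linarith)
    have := intervalIntegral.norm_integral_le_of_norm_le_const (a := c - 1) (b := c)
      (f := fun x : ℝ => h (x + (-T : ℝ) * I)) (C := 8 * K * Real.exp ((κ - Real.pi) * T)) ?_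
    · simpa using this
    · intro x hx
      rw [Set.uIoc_of_le (by linarith)] at hx
      have := hhor x (-T) hx.1.le hx.2 (by rw [hT']; exact hT)
      rwa [hT'] at this
  have v1 := intervalIntegral_tendsto_integral i1' tendsto_neg_atTop_atBot tendsto_id
  have v2 := intervalIntegral_tendsto_integral i2' tendsto_neg_atTop_atBot tendsto_id
  have hall := ((hh2.sub hh1).add (v1.const_smul I)).sub (v2.const_smul I)
  have hz := tendsto_nhds_unique hall (by
    simp only [id]
    simp_rw [hrect]
    exact tendsto_const_nhds)
  simp only [sub_zero, zero_add, smul_eq_mul] at hz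
  have heq : (∫ τ : ℝ, h (c + τ * I)) = ∫ τ : ℝ, h ((c - 1 : ℝ) + τ * I) :=
    mul_left_cancel₀ I_ne_zero (sub_eq_zero.1 hz)
  simp_rw [l1, l2] at heq
  rw [integral_sub i1 (i3.const_mul _), integral_sub (i3.const_mul _) i2,
    integral_const_mul] at heq
  linear_combination heq

open Complex Filter Topology in
lemma ml_decay (α c : ℝ) (hα : 0 < α) (hα2 : α < 2) (hc : 0 < c) (hc1 : c < 1) :
    ∃ C : ℝ, ∀ x : ℝ, 0 < x → |mittagLeffler α (-x)| ≤ C * x ^ (-c) := by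
  have hpi := Real.pi_pos
  -- exponents
  obtain ⟨κ₀, hκ₀, hκ₁⟩ : ∃ κ₀ : ℝ, Real.pi / 2 < κ₀ ∧ α * κ₀ < Real.pi := by
    have : Real.pi / 2 < Real.pi / α := div_lt_div_of_pos_left hpi hα hα2
    obtain ⟨q, h1, h2⟩ := exists_between this
    exact ⟨q, h1, by rw [lt_div_iff₀ hα] at h2; linarith⟩
  have hκ₀0 : 0 < κ₀ := by linarith
  set κ := α * κ₀ with hκ
  have hκ0 : 0 ≤ κ := by positivity
  set W := ∫ τ : ℝ, Real.exp (κ * |τ|) * ‖sin (Real.pi * (c + τ * I))‖⁻¹ with hW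
  have hW0 : 0 ≤ W := integral_nonneg fun τ => by positivity
  set S := ∫ τ : ℝ, 1 / sin (Real.pi * (c + τ * I)) with hS
  have hS0 : S ≠ 0 := ml_S_ne c hc hc1
  have harg : ∀ (N : ℕ) (a τ : ℝ), (1 + α * N - α * (a + τ * I) : ℂ) =
      ((1 + α * N - α * a : ℝ) : ℂ) + ((-(α * τ) : ℝ) : ℂ) * I := by
    intro N a τ; push_cast; ring
  have habs : ∀ τ : ℝ, |-(α * τ)| = α * |τ| := by
    intro τ; rw [abs_neg, abs_mul, abs_of_pos hα]
  have hxn : ∀ x : ℝ, 0 < x → ∀ a τ : ℝ, ‖(x : ℂ) ^ (-(a + τ * I : ℂ))‖ = x ^ (-a) := by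
    intro x hx a τ
    rw [norm_cpow_eq_rpow_re_of_pos hx]; simp
  set ψ : ℝ → ℕ → ℂ → ℂ := fun x N s => (x : ℂ) ^ (-s) * (Gamma (1 + α * N - α * s))⁻¹ with hψ
  have hψd : ∀ x : ℝ, 0 < x → ∀ N, Differentiable ℂ (ψ x N) := by
    intro x hx N
    apply Differentiable.mul
    · intro s
      exact DifferentiableAt.const_cpow (by fun_prop) (Or.inl (by exact_mod_cast hx.ne'))
    · exact differentiable_one_div_Gamma.comp (by fun_prop)
  have hψc : ∀ x : ℝ, 0 < x → ∀ N, Continuous fun τ : ℝ => ψ x N (c + τ * I) := by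
    intro x hx N
    exact (hψd x hx N).continuous.comp (by fun_prop)
  set J : ℝ → ℕ → ℂ := fun x N => ∫ τ : ℝ, ψ x N (c + τ * I) / sin (Real.pi * (c + τ * I)) with hJ
  -- recursion
  have hrec : ∀ x : ℝ, 0 < x → ∀ N : ℕ,
      J x N + x * J x (N + 1) = 2 * (Real.Gamma (1 + α * N) : ℂ)⁻¹ * S := by
    intro x hx N
    obtain ⟨K, hK0, hK⟩ := ml_inv_Gamma_poly (1 + α * N + α) κ₀ hκ₀
    have hsh := ml_shift c κ ((x ^ (-c) + x ^ (-(c-1))) * K) hc hc1 hκ0 hκ₁ (ψ x N) (hψd x hx N) ?_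
    · have e0 : ψ x N 0 = (Real.Gamma (1 + α * N) : ℂ)⁻¹ := by
        simp only [hψ]
        rw [← Gamma_ofReal]; simp
      rw [e0] at hsh
      rw [← hsh]
      congr 1
      simp only [hJ]
      rw [← integral_const_mul]
      congr 1
      ext τ
      rw [← mul_div_assoc]
      congr 1
      simp only [hψ]
      rw [← mul_assoc]
      congr 2
      · rw [show (-(((c - 1 : ℝ) : ℂ) + τ * I)) = 1 + -(c + τ * I) by push_cast; ring,
          cpow_add _ _ (by exact_mod_cast hx.ne'), cpow_one]
      · congr 1; push_cast; ring
    · intro a τ ha1 ha2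
      simp only [hψ]
      rw [norm_mul, hxn x hx, harg]
      have h1 := hK (1 + α * N - α * a) (-(α * τ)) ?_ ?_
      · rw [habs] at h1
        have hxa : x ^ (-a) ≤ x ^ (-c) + x ^ (-(c-1)) := by
          have p1 : 0 ≤ x ^ (-c) := by positivity
          have p2 : 0 ≤ x ^ (-(c-1)) := by positivity
          rcases le_total 1 x with h | h
          · have := Real.rpow_le_rpow_of_exponent_le h (show -a ≤ -(c-1) by linarith)
            linarith
          · have := Real.rpow_le_rpow_of_exponent_ge hx h (show -c ≤ -a by linarith)
            linarith
        calc _ ≤ (x ^ (-c) + x ^ (-(c-1))) * (K * Real.exp (κ₀ * (α * |τ|))) := by gcongr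
          _ = _ := by rw [hκ, ← mul_assoc, show κ₀ * (α * |τ|) = α * κ₀ * |τ| by ring]
      · have : 0 ≤ α * N := by positivity
        nlinarith
      · nlinarith
  -- first bound
  obtain ⟨K, hK0, hK⟩ := ml_inv_Gamma_poly 1 κ₀ hκ₀
  have hJ0 : ∀ x : ℝ, 0 < x → ‖J x 0‖ ≤ x ^ (-c) * K * W := by
    intro x hx
    refine (ml_line_int c κ (x ^ (-c) * K) hc hc1 hκ₁ _ (hψc x hx 0) ?_).2
    intro τ
    simp only [hψ]
    rw [norm_mul, hxn x hx, harg]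
    have h1 := hK (1 + α * (0:ℕ) - α * c) (-(α * τ)) (by simp; nlinarith) (by simp; positivity)
    rw [habs] at h1
    calc _ ≤ x ^ (-c) * (K * Real.exp (κ₀ * (α * |τ|))) := by gcongr
      _ = _ := by rw [hκ, ← mul_assoc, show κ₀ * (α * |τ|) = α * κ₀ * |τ| by ring]
  -- tail bound
  have hJN : ∀ x : ℝ, 0 < x → ∀ N : ℕ,
      ‖J x (N + 1)‖ ≤ x ^ (-c) * (Real.Gamma (1 + α * (N + 1 : ℕ) - α * c))⁻¹ * W := by
    intro x hx N
    have hpos : 1 < 1 + α * (N + 1 : ℕ) - α * c := by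
      have : 0 ≤ α * N := by positivity
      push_cast
      nlinarith
    have hG := Real.Gamma_pos_of_pos (zero_lt_one.trans hpos)
    refine (ml_line_int c κ _ hc hc1 hκ₁ _ (hψc x hx (N + 1)) ?_).2
    intro τ
    simp only [hψ]
    rw [norm_mul, hxn x hx, harg]
    have h1 := ml_inv_Gamma (1 + α * (N + 1 : ℕ) - α * c) (-(α * τ)) (by linarith)
    rw [habs] at h1
    rw [mul_assoc]
    gcongr
    refine h1.trans ?_
    rw [div_eq_inv_mul]
    have h5 : Real.pi / 2 * (α * |τ|) ≤ κ₀ * (α * |τ|) := by gcongr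
    refine mul_le_mul_of_nonneg_left (Real.exp_le_exp.2 ?_) (inv_nonneg.2 hG.le)
    rw [hκ]
    linarith
  -- telescoped sum
  have htel : ∀ x : ℝ, 0 < x → ∀ N : ℕ, J x 0 =
      2 * S * ((∑ k ∈ Finset.range N, (-x) ^ k / Real.Gamma (1 + α * k) : ℝ) : ℂ) +
        (-x : ℂ) ^ N * J x N := by
    intro x hx N
    induction N with
    | zero => simp
    | succ N ih =>
      rw [ih, Finset.sum_range_succ, eq_sub_of_add_eq (hrec x hx N)]
      push_cast
      rw [pow_succ]
      ring
  have hlim : ∀ x : ℝ, 0 < x → Tendsto (fun N : ℕ => (-x : ℂ) ^ N * J x N) atTop (𝓝 0) := by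
    intro x hx
    rw [← tendsto_add_atTop_iff_nat 1]
    set R := (2 * x) ^ (1/α) with hR
    have hR0 : 0 < R := by positivity
    have hRα : R ^ α = 2 * x := by
      rw [hR, ← Real.rpow_mul (by positivity), one_div_mul_cancel hα.ne', Real.rpow_one]
    have hg : Tendsto (fun N : ℕ => (x ^ (-c) * W * R ^ (α * c) * Real.exp R) * (1/2 : ℝ) ^ (N + 1))
        atTop (𝓝 0) := by
      have := (tendsto_pow_atTop_nhds_zero_of_lt_one (r := (1/2 : ℝ)) (by norm_num)
        (by norm_num)).comp (tendsto_add_atTop_nat 1)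
      simpa using this.const_mul (x ^ (-c) * W * R ^ (α * c) * Real.exp R)
    apply squeeze_zero_norm _ hg
    intro N
    have hpos : 1 ≤ 1 + α * (N + 1 : ℕ) - α * c := by
      have : 0 ≤ α * N := by positivity
      push_cast
      nlinarith
    have hl := ml_Gamma_lower R _ hR0 hpos
    rw [show 1 + α * (N + 1 : ℕ) - α * c - 1 = α * (N + 1 : ℕ) - α * c by ring,
      Real.rpow_sub hR0, Real.rpow_mul hR0.le, hRα, Real.rpow_natCast] at hl
    have hlp : 0 < (2 * x) ^ (N + 1) / R ^ (α * c) * Real.exp (-R) := by positivity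
    rw [norm_mul, norm_pow, norm_neg, norm_real, Real.norm_of_nonneg hx.le]
    calc x ^ (N + 1) * ‖J x (N + 1)‖
        ≤ x ^ (N + 1) * (x ^ (-c) * ((2 * x) ^ (N + 1) / R ^ (α * c) * Real.exp (-R))⁻¹ * W) := by
          gcongr
          refine (hJN x hx N).trans ?_
          gcongr
      _ = _ := by
          rw [mul_pow, Real.exp_neg, one_div, inv_pow]
          field_simp
  have hfin : ∀ x : ℝ, 0 < x → J x 0 = 2 * S * (mittagLeffler α (-x) : ℂ) := by
    intro x hx
    have h1 := (ml_summable α hα (-x)).hasSum.tendsto_sum_nat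
    have h2 := ((continuous_ofReal.tendsto _).comp h1).const_mul (2 * S)
    have h3 := h2.add (hlim x hx)
    rw [add_zero] at h3
    refine tendsto_nhds_unique ?_ h3
    refine tendsto_const_nhds.congr fun N => ?_
    exact htel x hx N
  refine ⟨K * W / (2 * ‖S‖), fun x hx => ?_⟩
  have h1 := hJ0 x hx
  have hSp : 0 < ‖S‖ := norm_pos_iff.2 hS0
  rw [hfin x hx, norm_mul, norm_mul, norm_real, Real.norm_eq_abs] at h1
  rw [div_mul_eq_mul_div, le_div_iff₀ (by positivity)]
  simp at h1
  linarith

lemma ml_bound (α c : ℝ) (hα : 0 < α) (hα2 : α < 2) (hc : 0 < c) (hc1 : c < 1) :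
    ∃ C : ℝ, 0 ≤ C ∧ ∀ x : ℝ, 0 ≤ x → |mittagLeffler α (-x)| ≤ C * (1 + x) ^ (-c) := by
  obtain ⟨C, hC⟩ := ml_decay α c hα hα2 hc hc1
  set D := ∑' k : ℕ, (1:ℝ) ^ k / Real.Gamma (1 + α * k) with hD
  have hG : ∀ k : ℕ, 0 < Real.Gamma (1 + α * k) := fun k => Real.Gamma_pos_of_pos (by positivity)
  have hD0 : 0 ≤ D := tsum_nonneg fun k => by have := hG k; positivity
  have h2 : (0:ℝ) < 2 ^ c := by positivity
  refine ⟨(|C| + D) * 2 ^ c, by positivity, fun x hx => ?_⟩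
  rcases le_total x 1 with h | h
  · have hb : |mittagLeffler α (-x)| ≤ D := by
      rw [← Real.norm_eq_abs, mittagLeffler]
      apply tsum_of_norm_bounded (ml_summable α hα 1).hasSum
      intro k
      have := hG k
      rw [norm_div, norm_pow, norm_neg, Real.norm_of_nonneg hx, Real.norm_of_nonneg this.le]
      gcongr
    have h3 : (2:ℝ) ^ (-c) ≤ (1 + x) ^ (-c) :=
      Real.rpow_le_rpow_of_nonpos (by linarith) (by linarith) (by linarith)
    calc _ ≤ D := hb
      _ ≤ (|C| + D) := by linarith [abs_nonneg C]
      _ = (|C| + D) * 2 ^ c * 2 ^ (-c) := by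
        rw [mul_assoc, ← Real.rpow_add two_pos]; simp
      _ ≤ _ := by gcongr
  · have hx0 : 0 < x := by linarith
    have h3 : (2 * x) ^ (-c) ≤ (1 + x) ^ (-c) :=
      Real.rpow_le_rpow_of_nonpos (by linarith) (by linarith) (by linarith)
    calc _ ≤ C * x ^ (-c) := hC x hx0
      _ ≤ (|C| + D) * x ^ (-c) := by gcongr; linarith [le_abs_self C]
      _ = (|C| + D) * 2 ^ c * (2 * x) ^ (-c) := by
        rw [Real.mul_rpow two_pos.le hx, mul_assoc, ← mul_assoc (2 ^ c), ← Real.rpow_add two_pos]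
        simp
      _ ≤ _ := by gcongr

/-- for `n ≥ 1`, `0 < α < 2`, `t > 0` and `s < 2 − n/2`, the function
`ξ ↦ E_α(−|ξ|² t^α)` lies in the Fourier-side description of `H^s(ℝⁿ)`:
`∫ (1+|ξ|²)^s |E_α(−|ξ|² t^α)|² dξ < ∞`. -/
theorem mittagLeffler_fundamental_solution_mem_Hs
    (n : ℕ) (hn : 1 ≤ n) (α : ℝ) (hα0 : 0 < α) (hα2 : α < 2)
    (t : ℝ) (ht : 0 < t) (s : ℝ) (hs : s < 2 - n / 2) :
    ∫⁻ ξ : EuclideanSpace ℝ (Fin n),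
        ENNReal.ofReal ((1 + ‖ξ‖ ^ 2) ^ s * (mittagLeffler α (-(‖ξ‖ ^ 2) * t ^ α)) ^ 2) < ⊤ := by
  obtain ⟨c, hc, hc1⟩ : ∃ c : ℝ, max 0 ((s + n / 2) / 2) < c ∧ c < 1 :=
    exists_between (max_lt one_pos (by linarith))
  have hc0 : 0 < c := (le_max_left _ _).trans_lt hc
  have hc2 : (s + n / 2) / 2 < c := (le_max_right _ _).trans_lt hc
  obtain ⟨C, hC0, hC⟩ := ml_bound α c hα0 hα2 hc0 hc1
  set m := min 1 (t ^ α) with hm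
  have hta : 0 < t ^ α := by positivity
  have hm0 : 0 < m := lt_min one_pos hta
  have hint : Integrable (fun ξ : EuclideanSpace ℝ (Fin n) =>
      (C * m ^ (-c)) ^ 2 * (1 + ‖ξ‖ ^ 2) ^ (-(4 * c - 2 * s) / 2)) :=
    (integrable_rpow_neg_one_add_norm_sq (by simp; linarith)).const_mul _
  refine lt_of_le_of_lt (lintegral_mono fun ξ => ENNReal.ofReal_le_ofReal ?_) hint.lintegral_lt_top
  have hq : 0 < 1 + ‖ξ‖ ^ 2 := by positivity
  have h1 := hC (‖ξ‖ ^ 2 * t ^ α) (by positivity)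
  rw [← neg_mul] at h1
  have h2 : (1 + ‖ξ‖ ^ 2 * t ^ α) ^ (-c) ≤ (m * (1 + ‖ξ‖ ^ 2)) ^ (-c) := by
    apply Real.rpow_le_rpow_of_nonpos (by positivity) _ (by linarith)
    have e1 : m ≤ 1 := min_le_left _ _
    have e2 : m ≤ t ^ α := min_le_right _ _
    have e3 : 0 ≤ ‖ξ‖ ^ 2 := by positivity
    nlinarith
  rw [Real.mul_rpow hm0.le hq.le] at h2
  have h3 : |mittagLeffler α (-(‖ξ‖ ^ 2) * t ^ α)| ≤ C * m ^ (-c) * (1 + ‖ξ‖ ^ 2) ^ (-c) := by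
    refine h1.trans ?_
    rw [mul_assoc]
    gcongr
  have h4 := pow_le_pow_left₀ (abs_nonneg _) h3 2
  rw [sq_abs] at h4
  calc _ ≤ (1 + ‖ξ‖ ^ 2) ^ s * (C * m ^ (-c) * (1 + ‖ξ‖ ^ 2) ^ (-c)) ^ 2 := by gcongr
    _ = (C * m ^ (-c)) ^ 2 * ((1 + ‖ξ‖ ^ 2) ^ s * ((1 + ‖ξ‖ ^ 2) ^ (-c)) ^ 2) := by ring
    _ = _ := by
      rw [← Real.rpow_natCast ((1 + ‖ξ‖ ^ 2) ^ (-c)), ← Real.rpow_mul hq.le, ← Real.rpow_add hq]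
      congr 2
      push_cast; ring
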